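/- Flux slice integral vanishes: Let d ≥ 2, let ā ∈ ℝ^{d×d} be constant, elliptic, and bounded, and let h̄ ∈ H¹_loc(ℍ^d_+) ∩ C¹ away from supp(g) satisfy −∇·(ā∇h̄) = ∇·g in ℍ^d_+ with g ∈ C_c^∞ compactly supported in the interior of ℍ^d_+, and suppose |∇h̄(x)| ≤ C/dist(x, supp g)^d for x ∉ supp g. Then for every R ≥ 0 with the hyperplane {x₁ = R} disjoint from supp g: ∫_{{x₁ = R}} e₁ · ā∇h̄ dS = 0 (as an improper integral over ℝ^{d−1}, in the sense of limits over expanding cubes). -/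

import Mathlib

open MeasureTheory Metric Filter
open scoped RealInnerProductSpace Topology

/-- Coordinates. -/
noncomputable def sliceE (m : ℕ) (p : ℝ × EuclideanSpace ℝ (Fin m)) :
    EuclideanSpace ℝ (Fin (m + 1)) :=
  WithLp.toLp 2 (Fin.cons p.1 (WithLp.ofLp p.2) : Fin (m + 1) → ℝ)

lemma sliceE_zero (m : ℕ) (p) : sliceE m p 0 = p.1 := by simp [sliceE]

lemma sliceE_cont (m : ℕ) : Continuous (sliceE m) := by
  unfold sliceE
  refine (PiLp.continuous_toLp 2 _).comp ?_
  refine continuous_pi fun i => ?_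
  refine Fin.cases ?_ (fun j => ?_) i
  · simpa using continuous_fst
  · simp only [Fin.cons_succ]; fun_prop

lemma sliceE_norm (m : ℕ) (p) : ‖p.2‖ ≤ ‖sliceE m p‖ := by
  rw [EuclideanSpace.norm_eq, EuclideanSpace.norm_eq]
  apply Real.sqrt_le_sqrt
  rw [Fin.sum_univ_succ]
  simp only [sliceE, Fin.cons_succ]
  have := sq_nonneg ‖(Fin.cons p.1 (WithLp.ofLp p.2) : Fin (m + 1) → ℝ) 0‖
  linarith

noncomputable def sliceEquiv (m : ℕ) :
    ℝ × EuclideanSpace ℝ (Fin m) ≃ᵐ EuclideanSpace ℝ (Fin (m + 1)) :=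
  ((MeasurableEquiv.prodCongr (MeasurableEquiv.refl ℝ)
    (MeasurableEquiv.toLp 2 (Fin m → ℝ)).symm).trans
    (MeasurableEquiv.piFinSuccAbove (fun _ => ℝ) 0).symm).trans
    (MeasurableEquiv.toLp 2 (Fin (m + 1) → ℝ))

lemma sliceEquiv_eq (m : ℕ) : ⇑(sliceEquiv m) = sliceE m := by
  funext p
  simp [sliceEquiv, sliceE]
  rfl

lemma sliceE_mp (m : ℕ) : MeasurePreserving (sliceE m) (volume.prod volume) volume := by
  rw [← sliceEquiv_eq]
  have h1 : MeasurePreserving (MeasurableEquiv.prodCongr (MeasurableEquiv.refl ℝ)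
    (MeasurableEquiv.toLp 2 (Fin m → ℝ)).symm) (volume.prod volume) (volume.prod volume) :=
    (MeasurePreserving.id volume).prod (PiLp.volume_preserving_ofLp (Fin m))
  have h2 := (volume_preserving_piFinSuccAbove (fun _ : Fin (m+1) => ℝ) 0).symm
  have h3 := PiLp.volume_preserving_toLp (Fin (m+1))
  exact h3.comp (h2.comp h1)

lemma sliceE_emb (m : ℕ) : MeasurableEmbedding (sliceE m) := by
  rw [← sliceEquiv_eq]; exact (sliceEquiv m).measurableEmbedding

lemma exists_primitive (ρ : ℝ → ℝ) (R e : ℝ) (h1 : ContDiff ℝ (⊤ : ℕ∞) ρ)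
    (h2 : HasCompactSupport ρ) (h3 : tsupport ρ ⊆ Set.Ioo R (R + e)) :
    ∃ η : ℝ → ℝ, ContDiff ℝ (⊤ : ℕ∞) η ∧ (∀ t, HasDerivAt η (ρ t) t) ∧
      (∃ a, R < a ∧ ∀ t, t ≤ a → η t = 0) ∧ ∃ M, 0 ≤ M ∧ ∀ t, |η t| ≤ M := by
  have hd : ∀ t, HasDerivAt (fun t => ∫ s in R..t, ρ s) (ρ t) t := fun t =>
    h1.continuous.integral_hasStrictDerivAt R t |>.hasDerivAt
  refine ⟨fun t => ∫ s in R..t, ρ s, ?_, hd, ?_, ?_⟩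
  · rw [contDiff_infty_iff_deriv]
    refine ⟨fun t => (hd t).differentiableAt, ?_⟩
    rwa [show deriv (fun t => ∫ s in R..t, ρ s) = ρ from funext fun t => (hd t).deriv]
  · have : ∃ a, R < a ∧ ∀ t, t < a → ρ t = 0 := by
      rcases (tsupport ρ).eq_empty_or_nonempty with h0 | h0
      · refine ⟨R + 1, by linarith, fun t _ => image_eq_zero_of_notMem_tsupport ?_⟩
        simp [h0]
      · obtain ⟨a, ha⟩ := IsCompact.exists_isLeast h2 h0
        refine ⟨a, (h3 ha.1).1, fun t ht => image_eq_zero_of_notMem_tsupport fun h => ?_⟩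
        exact absurd (ha.2 h) (not_le.2 ht)
    obtain ⟨a, ha, ha2⟩ := this
    refine ⟨(R + a)/2, by linarith, fun t ht => ?_⟩
    change ∫ s in R..t, ρ s = 0
    rw [intervalIntegral.integral_congr (g := fun _ => (0:ℝ))]
    · simp
    · intro s hs
      apply ha2
      rcases le_total R t with h | h
      · rw [Set.uIcc_of_le h] at hs; linarith [hs.2]
      · rw [Set.uIcc_of_ge h] at hs; linarith [hs.2]
  · have hi : Integrable ρ := h1.continuous.integrable_of_hasCompactSupport h2
    refine ⟨∫ s, ‖ρ s‖, integral_nonneg fun _ => norm_nonneg _, fun t => ?_⟩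
    change ‖∫ s in R..t, ρ s‖ ≤ _
    refine (intervalIntegral.norm_integral_le_integral_norm_uIoc).trans ?_
    exact setIntegral_le_integral hi.norm (Eventually.of_forall fun _ => norm_nonneg _)

lemma exists_cutoff (X : Type*) [NormedAddCommGroup X] [InnerProductSpace ℝ X]
    [FiniteDimensional ℝ X] : ∃ M : ℝ, 0 ≤ M ∧ ∀ n : ℝ, 0 < n →
    ∃ χ : X → ℝ, ContDiff ℝ (⊤ : ℕ∞) χ ∧ HasCompactSupport χ ∧ (∀ x, |χ x| ≤ 1) ∧
      (∀ x, ‖x‖ ≤ n → χ x = 1) ∧ (∀ x, ‖x‖ < n → fderiv ℝ χ x = 0) ∧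
      (∀ x, 2 * n < ‖x‖ → fderiv ℝ χ x = 0) ∧ ∀ x, ‖fderiv ℝ χ x‖ ≤ M / n := by
  let f : ContDiffBump (0 : X) := ⟨1, 2, one_pos, one_lt_two⟩
  have hfc : ContDiff ℝ (⊤ : ℕ∞) f := f.contDiff
  have hfs : HasCompactSupport f := f.hasCompactSupport
  obtain ⟨M, hM⟩ := (hfc.continuous_fderiv (by simp)).bounded_above_of_compact_support (hfs.fderiv ℝ)
  refine ⟨M, (norm_nonneg _).trans (hM 0), fun n hn => ?_⟩
  have hone : ∀ x : X, ‖x‖ ≤ n → f (n⁻¹ • x) = 1 := by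
    intro x hx
    apply f.one_of_mem_closedBall
    rw [mem_closedBall_zero_iff, norm_smul, norm_inv, Real.norm_of_nonneg hn.le]
    change n⁻¹ * ‖x‖ ≤ 1
    rw [inv_mul_le_iff₀ hn]; linarith
  have hzero : ∀ x : X, 2 * n < ‖x‖ → f (n⁻¹ • x) = 0 := by
    intro x hx
    apply f.zero_of_le_dist
    rw [dist_zero_right, norm_smul, norm_inv, Real.norm_of_nonneg hn.le]
    change 2 ≤ n⁻¹ * ‖x‖
    rw [le_inv_mul_iff₀ hn]; linarith
  refine ⟨fun x => f (n⁻¹ • x), hfc.comp (contDiff_const_smul _), ?_, ?_, hone, ?_, ?_, ?_⟩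
  · refine HasCompactSupport.of_support_subset_isCompact (isCompact_closedBall (0:X) (2*n)) ?_
    intro x hx
    rw [mem_closedBall_zero_iff]
    by_contra h
    exact hx (hzero x (not_le.1 h))
  · intro x
    rw [abs_of_nonneg f.nonneg]; exact f.le_one
  · intro x hx
    have : (fun x : X => f (n⁻¹ • x)) =ᶠ[𝓝 x] fun _ => (1:ℝ) := by
      filter_upwards [(isOpen_lt continuous_norm continuous_const).mem_nhds hx] with y hy
      exact hone y (le_of_lt hy)
    rw [this.fderiv_eq]; simp
  · intro x hx
    have : (fun x : X => f (n⁻¹ • x)) =ᶠ[𝓝 x] fun _ => (0:ℝ) := by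
      filter_upwards [(isOpen_lt continuous_const continuous_norm).mem_nhds hx] with y hy
      exact hzero y hy
    rw [this.fderiv_eq]; simp
  · intro x
    rw [fderiv_comp_smul, norm_smul, norm_inv, Real.norm_of_nonneg hn.le, inv_mul_eq_div]
    gcongr
    exact hM _

lemma slice_bound_int (m : ℕ) : Integrable
    (fun y : EuclideanSpace ℝ (Fin m) => (1 + ‖y‖) ^ (-((m : ℝ) + 1))) :=
  integrable_one_add_norm (by simp)

lemma rpow_slice_le (m : ℕ) (p : ℝ × EuclideanSpace ℝ (Fin m)) :
    (1 + ‖sliceE m p‖) ^ (-((m : ℝ) + 1)) ≤ (1 + ‖p.2‖) ^ (-((m : ℝ) + 1)) := by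
  apply Real.rpow_le_rpow_of_nonpos (by positivity) (by linarith [sliceE_norm m p])
  have : (0:ℝ) ≤ m := by positivity
  linarith

lemma coord_le_norm {m : ℕ} (x : EuclideanSpace ℝ (Fin m)) (i : Fin m) : |x i| ≤ ‖x‖ := by
  simpa using PiLp.norm_apply_le x i

lemma key (m : ℕ) (V : EuclideanSpace ℝ (Fin (m + 1)) → EuclideanSpace ℝ (Fin (m + 1)))
    (hV : Measurable V) (R e L C : ℝ) (hR : 0 ≤ R) (hC : 0 ≤ C)
    (hdec : ∀ x, 0 < x 0 → (x 0 ∈ Set.Icc R (R + e) ∨ L ≤ ‖x‖) →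
      ‖V x‖ ≤ C * (1 + ‖x‖) ^ (-((m : ℝ) + 1)))
    (hw : ∀ φ : EuclideanSpace ℝ (Fin (m + 1)) → ℝ,
      ContDiff ℝ (⊤ : ℕ∞) φ → HasCompactSupport φ → tsupport φ ⊆ {x | 0 < x 0} →
      (∀ x, ‖x‖ ≤ L → x 0 ∉ Set.Ioo R (R + e) → fderiv ℝ φ x = 0) →
      ∫ x in {x : EuclideanSpace ℝ (Fin (m + 1)) | 0 < x 0}, fderiv ℝ φ x (V x) = 0)
    (ρ : ℝ → ℝ) (h1 : ContDiff ℝ (⊤ : ℕ∞) ρ)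
    (h2 : HasCompactSupport ρ) (h3 : tsupport ρ ⊆ Set.Ioo R (R + e)) :
    ∫ t, ρ t • ∫ y, V (sliceE m (t, y)) 0 = 0 := by
  obtain ⟨η, hη, hηd, ⟨a, haR, ha⟩, Mη, hMη0, hMη⟩ := exists_primitive ρ R e h1 h2 h3
  obtain ⟨M, hM0, hM⟩ := exists_cutoff (EuclideanSpace ℝ (Fin (m + 1)))
  choose! χ hχs hχc hχ1 hχone hχin hχout hχM using hM
  obtain ⟨Mρ, hMρ⟩ := h1.continuous.bounded_above_of_compact_support h2
  have hρ0 : ∀ t, t ∉ Set.Ioo R (R + e) → ρ t = 0 := fun t ht =>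
    image_eq_zero_of_notMem_tsupport fun h => ht (h3 h)
  have hV0 : Measurable fun x => V x 0 := by
    have : Continuous fun x : EuclideanSpace ℝ (Fin (m+1)) => x 0 := by fun_prop
    exact this.measurable.comp hV
  have hx0 : Continuous fun x : EuclideanSpace ℝ (Fin (m+1)) => x 0 := by fun_prop
  -- domination
  let B : ℝ × EuclideanSpace ℝ (Fin m) → ℝ := fun p =>
    ‖ρ p.1‖ * (C * (1 + ‖p.2‖) ^ (-((m : ℝ) + 1)))
  have hB : Integrable B (volume.prod volume) :=
    (h1.continuous.integrable_of_hasCompactSupport h2).norm.mul_prod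
      ((slice_bound_int m).const_mul C)
  have hVB : ∀ p, ‖ρ p.1 * V (sliceE m p) 0‖ ≤ B p := by
    intro p
    rw [norm_mul]
    by_cases hp : p.1 ∈ Set.Ioo R (R + e)
    · apply mul_le_mul_of_nonneg_left _ (norm_nonneg _)
      refine (coord_le_norm _ _).trans ((hdec _ ?_ (Or.inl ?_)).trans ?_)
      · rw [sliceE_zero]; linarith [hp.1]
      · rw [sliceE_zero]; exact ⟨hp.1.le, hp.2.le⟩
      · exact mul_le_mul_of_nonneg_left (rpow_slice_le m p) hC
    · simp [B, hρ0 _ hp]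
  have hmeas : AEStronglyMeasurable (fun p => ρ p.1 * V (sliceE m p) 0)
      ((volume : Measure ℝ).prod (volume : Measure (EuclideanSpace ℝ (Fin m)))) := by
    apply Measurable.aestronglyMeasurable
    exact (h1.continuous.measurable.comp measurable_fst).mul
      (hV0.comp (sliceE_cont m).measurable)
  have hint : Integrable (fun p => ρ p.1 * V (sliceE m p) 0)
      ((volume : Measure ℝ).prod (volume : Measure (EuclideanSpace ℝ (Fin m)))) :=
    hB.mono' hmeas (Eventually.of_forall hVB)
  have hgoal : ∫ t, ρ t • ∫ y, V (sliceE m (t, y)) 0 =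
      ∫ p, ρ p.1 * V (sliceE m p) 0 ∂((volume : Measure ℝ).prod volume) := by
    rw [integral_prod _ hint]
    simp only [integral_const_mul, smul_eq_mul]
  rw [hgoal]
  let I1 : ℕ → ℝ := fun n => ∫ p, χ (n + 1) (sliceE m p) * (ρ p.1 * V (sliceE m p) 0)
    ∂((volume : Measure ℝ).prod volume)
  have hnpos : ∀ n : ℕ, (0:ℝ) < n + 1 := fun n => by positivity
  have hF1 : ∀ n : ℕ, ∀ p, ‖χ (n + 1) (sliceE m p) * (ρ p.1 * V (sliceE m p) 0)‖ ≤ B p := by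
    intro n p
    rw [norm_mul]
    calc _ ≤ 1 * B p := mul_le_mul (hχ1 _ (hnpos n) _) (hVB p) (norm_nonneg _) zero_le_one
      _ = _ := one_mul _
  have hF1m : ∀ n : ℕ, AEStronglyMeasurable
      (fun p => χ (n + 1) (sliceE m p) * (ρ p.1 * V (sliceE m p) 0))
      ((volume : Measure ℝ).prod (volume : Measure (EuclideanSpace ℝ (Fin m)))) := fun n =>
    ((hχs _ (hnpos n)).continuous.comp (sliceE_cont m)).aestronglyMeasurable.mul hmeas
  have hI1 : Tendsto I1 atTop
      (𝓝 (∫ p, ρ p.1 * V (sliceE m p) 0 ∂((volume : Measure ℝ).prod volume))) := by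
    refine tendsto_integral_of_dominated_convergence B hF1m hB
      (fun n => Eventually.of_forall (hF1 n)) (Eventually.of_forall fun p => ?_)
    apply tendsto_const_nhds.congr'
    obtain ⟨N, hN⟩ := exists_nat_ge ‖sliceE m p‖
    filter_upwards [eventually_ge_atTop N] with n hn
    have : (N:ℝ) ≤ n := by exact_mod_cast hn
    rw [hχone _ (hnpos n) _ (by linarith), one_mul]
  have hI1' : ∀ n : ℕ, I1 n = ∫ x, χ (n + 1) x * (ρ (x 0) * V x 0) := by
    intro n
    rw [← (sliceE_mp m).integral_comp (sliceE_emb m)]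
    simp only [sliceE_zero, I1]
  have hF1i : ∀ n : ℕ, Integrable (fun x => χ (n + 1) x * (ρ (x 0) * V x 0)) := by
    intro n
    rw [← (sliceE_mp m).integrable_comp_emb (sliceE_emb m)]
    have := hB.mono' (hF1m n) (Eventually.of_forall (hF1 n))
    simpa only [Function.comp_def, sliceE_zero] using this
  -- second term
  let F2 : ℕ → EuclideanSpace ℝ (Fin (m + 1)) → ℝ := fun n x =>
    η (x 0) * fderiv ℝ (χ (n + 1)) x (V x)
  have hb2 : ∀ n : ℕ, L ≤ n → ∀ x, ‖F2 n x‖ ≤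
      Mη * (M / (n + 1) * (C * (n + 1 : ℝ) ^ (-((m : ℝ) + 1)))) := by
    intro n hn x
    have hnn := hnpos n
    by_cases hx : 0 < x 0 ∧ (n:ℝ) + 1 ≤ ‖x‖
    · rw [norm_mul]
      refine mul_le_mul (hMη _) ?_ (norm_nonneg _) hMη0
      refine (ContinuousLinearMap.le_opNorm _ _).trans ?_
      refine mul_le_mul (hχM _ (hnpos n) x) ?_ (norm_nonneg _) (by positivity)
      refine (hdec x hx.1 (Or.inr (by linarith))).trans ?_
      apply mul_le_mul_of_nonneg_left _ hC
      apply Real.rpow_le_rpow_of_nonpos hnn (by linarith)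
      have : (0:ℝ) ≤ m := by positivity
      linarith
    · have : F2 n x = 0 := by
        by_cases h0 : 0 < x 0
        · have : ‖x‖ < n + 1 := by
            by_contra h; exact hx ⟨h0, not_lt.1 h⟩
          simp only [F2]
          rw [hχin _ hnn x this]; simp
        · simp only [F2]
          rw [ha _ (by linarith [not_lt.1 h0])]; simp
      rw [this, norm_zero]; positivity
  have hz2 : ∀ n : ℕ, ∀ x, x ∉ closedBall (0 : EuclideanSpace ℝ (Fin (m + 1))) (2 * (n + 1)) →
      F2 n x = 0 := by
    intro n x hx
    rw [mem_closedBall_zero_iff, not_le] at hx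
    simp only [F2]
    rw [hχout _ (hnpos n) x hx]; simp
  have hm2 : ∀ n : ℕ, AEStronglyMeasurable (F2 n) volume := by
    intro n
    apply Measurable.aestronglyMeasurable
    apply (hη.continuous.comp hx0).measurable.mul
    have hc : Continuous fun q : (EuclideanSpace ℝ (Fin (m + 1)) × EuclideanSpace ℝ (Fin (m + 1))) =>
        fderiv ℝ (χ (n + 1)) q.1 q.2 := by
      exact (((hχs _ (hnpos n)).continuous_fderiv (by simp)).comp continuous_fst).clm_apply
        continuous_snd
    exact hc.measurable.comp (measurable_id.prodMk hV)
  have hi2 : ∀ n : ℕ, L ≤ n → Integrable (F2 n) := by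
    intro n hn
    rw [← integrableOn_iff_integrable_of_support_subset
      (s := closedBall (0 : EuclideanSpace ℝ (Fin (m + 1))) (2 * (n + 1)))
      (fun x hx => by_contra fun h => hx (hz2 n x h))]
    exact Measure.integrableOn_of_bounded (isCompact_closedBall _ _).measure_lt_top.ne
      (hm2 n) (ae_of_all _ (hb2 n hn))
  let v : ℝ := (volume : Measure (EuclideanSpace ℝ (Fin (m + 1)))).real (ball 0 1)
  have hI2 : ∀ n : ℕ, L ≤ n → ‖∫ x, F2 n x‖ ≤ (Mη * M * C * 2 ^ (m + 1) * v) / (n + 1) := by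
    intro n hn
    have hnn := hnpos n
    rw [← setIntegral_eq_integral_of_forall_compl_eq_zero (hz2 n)]
    refine (norm_setIntegral_le_of_norm_le_const (isCompact_closedBall _ _).measure_lt_top
      (fun x _ => hb2 n hn x)).trans (le_of_eq ?_)
    rw [Measure.real, Measure.addHaar_closedBall _ _ (by positivity), ENNReal.toReal_mul,
      ENNReal.toReal_ofReal (by positivity)]
    rw [show ((volume : Measure (EuclideanSpace ℝ (Fin (m + 1)))) (ball 0 1)).toReal = v from rfl]
    rw [show (-((m : ℝ) + 1)) = -(((m + 1 : ℕ)) : ℝ) by push_cast; ring,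
      Real.rpow_neg hnn.le, Real.rpow_natCast]
    simp only [finrank_euclideanSpace, Fintype.card_fin, mul_pow]
    field_simp
  have hI2' : Tendsto (fun n => ∫ x, F2 n x) atTop (𝓝 0) := by
    have hl : Tendsto (fun n : ℕ => (Mη * M * C * 2 ^ (m + 1) * v) / ((n:ℝ) + 1)) atTop (𝓝 0) :=
      tendsto_const_nhds.div_atTop
        (tendsto_atTop_add_const_right _ _ tendsto_natCast_atTop_atTop)
    apply squeeze_zero_norm' _ hl
    obtain ⟨N, hN⟩ := exists_nat_ge L
    filter_upwards [eventually_ge_atTop N] with n hn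
    have : (N:ℝ) ≤ n := by exact_mod_cast hn
    exact hI2 n (by linarith)
  have hsum : ∀ n : ℕ, L ≤ n → I1 n + ∫ x, F2 n x = 0 := by
    intro n hn
    have hnn := hnpos n
    rw [hI1', ← integral_add (hF1i n) (hi2 n hn)]
    let φ : EuclideanSpace ℝ (Fin (m + 1)) → ℝ := fun x => η (x 0) * χ (n + 1) x
    have hder : ∀ x w, fderiv ℝ φ x w =
        χ (n + 1) x * (ρ (x 0) * w 0) + η (x 0) * fderiv ℝ (χ (n + 1)) x w := by
      intro x w
      have hp : HasFDerivAt (fun x : EuclideanSpace ℝ (Fin (m + 1)) => x 0)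
        (EuclideanSpace.proj (0 : Fin (m + 1)) : EuclideanSpace ℝ (Fin (m + 1)) →L[ℝ] ℝ) x :=
        (EuclideanSpace.proj (0 : Fin (m + 1)) :
          EuclideanSpace ℝ (Fin (m + 1)) →L[ℝ] ℝ).hasFDerivAt
      have h1 := (hηd (x 0)).comp_hasFDerivAt x hp
      have h2 := (((hχs _ hnn).differentiable (by simp)) x).hasFDerivAt
      have h3 := (h1.mul h2).fderiv
      have h4 : fderiv ℝ φ x = _ := h3
      rw [h4]
      simp [smul_eq_mul]
      ring
    have hsupp : tsupport φ ⊆ {x | a ≤ x 0} := by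
      apply closure_minimal _ (isClosed_le continuous_const hx0)
      intro x hx
      by_contra h
      apply hx
      simp only [φ]
      rw [ha _ (le_of_lt (not_le.1 h))]; simp
    have hw1 := hw φ ((hη.comp (by fun_prop)).mul (hχs _ hnn))
      ((hχc _ hnn).mul_left) (fun x hx => by
        have := hsupp hx
        simp only [Set.mem_ofPred_eq] at this ⊢
        linarith) (by
        intro x hx hx2
        ext w
        rw [hder, hρ0 _ hx2, hχin _ hnn x (by linarith)]
        simp)
    rw [setIntegral_eq_integral_of_forall_compl_eq_zero] at hw1
    · rw [← hw1]
      apply integral_congr_ae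
      exact Eventually.of_forall fun x => (hder x (V x)).symm
    · intro x hx
      simp only [Set.mem_ofPred_eq, not_lt] at hx
      rw [hder, ha _ (by linarith), hρ0 _ (fun h => by linarith [h.1])]
      simp
  have hfin := hI1.add hI2'
  rw [add_zero] at hfin
  refine tendsto_nhds_unique hfin ?_
  apply tendsto_const_nhds.congr'
  obtain ⟨N, hN⟩ := exists_nat_ge L
  filter_upwards [eventually_ge_atTop N] with n hn
  have : (N:ℝ) ≤ n := by exact_mod_cast hn
  exact (hsum n (by linarith)).symm

lemma decay_bound (m : ℕ) (K : Set (EuclideanSpace ℝ (Fin (m + 1)))) (hK : IsCompact K)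
    (w : EuclideanSpace ℝ (Fin (m + 1)) → EuclideanSpace ℝ (Fin (m + 1))) (C₀ : ℝ)
    (hdecay : ∀ x : EuclideanSpace ℝ (Fin (m + 1)), 0 < x 0 → x ∉ K →
      ‖w x‖ ≤ C₀ / (infDist x K) ^ (m + 1))
    (R : ℝ) (hRg : ∀ x ∈ K, x 0 ≠ R) :
    ∃ e L C : ℝ, 0 < e ∧ 0 ≤ C ∧ (∀ x ∈ K, ‖x‖ ≤ L) ∧ (∀ x ∈ K, x 0 ∉ Set.Icc R (R + e)) ∧
      ∀ x, 0 < x 0 → (x 0 ∈ Set.Icc R (R + e) ∨ L ≤ ‖x‖) →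
      ‖w x‖ ≤ C * (1 + ‖x‖) ^ (-((m : ℝ) + 1)) := by
  have hx0 : Continuous fun x : EuclideanSpace ℝ (Fin (m+1)) => x 0 := by fun_prop
  have him : IsClosed ((fun x : EuclideanSpace ℝ (Fin (m+1)) => x 0) '' K) :=
    (hK.image hx0).isClosed
  have hRn : R ∈ ((fun x : EuclideanSpace ℝ (Fin (m+1)) => x 0) '' K)ᶜ := by
    rintro ⟨x, hx, hxR⟩
    exact hRg x hx hxR
  obtain ⟨δ, hδ, hball⟩ := Metric.isOpen_iff.1 him.isOpen_compl R hRn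
  have hsep : ∀ x ∈ K, δ ≤ |x 0 - R| := by
    intro x hx
    by_contra h
    exact hball (show x 0 ∈ ball R δ by rw [mem_ball, Real.dist_eq]; exact not_le.1 h)
      ⟨x, hx, rfl⟩
  obtain ⟨L0, hL0⟩ := hK.isBounded.subset_closedBall 0
  have hL1 : ∀ x ∈ K, ‖x‖ ≤ max L0 0 := fun x hx =>
    (mem_closedBall_zero_iff.1 (hL0 hx)).trans (le_max_left _ _)
  set L1 := max L0 0 with hL1def
  have hL1n : 0 ≤ L1 := le_max_right _ _
  set c := (δ / 2) / (1 + L1 + δ / 2) with hc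
  have hcpos : 0 < c := by positivity
  refine ⟨δ / 2, L1 + δ / 2, |C₀| / c ^ (m + 1), by linarith, by positivity,
    fun x hx => (hL1 x hx).trans (by linarith), ?_, ?_⟩
  · intro x hx h
    have := hsep x hx
    rw [abs_of_nonneg (by linarith [h.1])] at this
    linarith [h.2]
  intro x hx hor
  have hxd : ∀ k ∈ K, δ / 2 ≤ dist x k := by
    intro k hk
    rcases hor with h | h
    · have h1 : |x 0 - k 0| ≤ dist x k := by
        rw [dist_eq_norm]; exact coord_le_norm (x - k) 0
      have h2 := hsep k hk
      have h3 : |k 0 - R| ≤ |x 0 - k 0| + |x 0 - R| := by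
        rw [abs_sub_comm (x 0)]
        calc |k 0 - R| = |(k 0 - x 0) + (x 0 - R)| := by ring_nf
          _ ≤ _ := abs_add_le _ _
      have h4 : |x 0 - R| ≤ δ / 2 := by
        rw [abs_of_nonneg (by linarith [h.1])]; linarith [h.2]
      linarith
    · have h1 : ‖x‖ ≤ dist x k + ‖k‖ := by
        rw [dist_eq_norm]
        simpa using norm_add_le (x - k) k
      linarith [hL1 k hk]
  have hxK : x ∉ K := fun h => by
    have := hxd x h
    rw [dist_self] at this; linarith
  refine (hdecay x hx hxK).trans ?_
  have hrw : (1 + ‖x‖) ^ (-((m : ℝ) + 1)) = ((1 + ‖x‖) ^ (m + 1))⁻¹ := by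
    rw [show (-((m : ℝ) + 1)) = -(((m + 1 : ℕ)) : ℝ) by push_cast; ring,
      Real.rpow_neg (by positivity), Real.rpow_natCast]
  rw [hrw]
  rcases K.eq_empty_or_nonempty with h0 | h0
  · subst h0
    simp only [infDist_empty]
    rw [zero_pow (by omega), div_zero]
    positivity
  have hD1 : δ / 2 ≤ infDist x K := (le_infDist h0).2 fun {k} hk => hxd k hk
  have hD2 : ‖x‖ - L1 ≤ infDist x K := (le_infDist h0).2 fun {k} hk => by
    have h1 : ‖x‖ ≤ dist x k + ‖k‖ := by
      rw [dist_eq_norm]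
      simpa using norm_add_le (x - k) k
    linarith [hL1 k hk]
  have hD3 : c * (1 + ‖x‖) ≤ infDist x K := by
    rw [hc, div_mul_eq_mul_div, div_le_iff₀ (by positivity)]
    nlinarith
  calc C₀ / (infDist x K) ^ (m + 1) ≤ |C₀| / (infDist x K) ^ (m + 1) := 
        div_le_div_of_nonneg_right (le_abs_self C₀) (pow_nonneg infDist_nonneg _)
    _ ≤ |C₀| / (c * (1 + ‖x‖)) ^ (m + 1) := by gcongr
    _ = _ := by rw [mul_pow]; field_simp

/-- The flux slice integral vanishes: with `d = m + 1`, if `h̄` weakly solves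
`-∇·(ā∇h̄) = ∇·g` in `ℍ^d_+` for a constant elliptic matrix `ā` and
`g ∈ C_c^∞` compactly supported in the interior, with the gradient decay
`|∇h̄(x)| ≤ C₀ / dist(x, supp g)^d`, then for every `R ≥ 0` whose hyperplane
`{x₁ = R}` avoids `supp g`, the improper slice integral of `e₁ · ā∇h̄` over
expanding cubes tends to `0`. -/
theorem stmt11 (m : ℕ) (hm : 1 ≤ m) (lam : ℝ) (hlam : 0 < lam)
    (abar : EuclideanSpace ℝ (Fin (m + 1)) →L[ℝ] EuclideanSpace ℝ (Fin (m + 1)))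
    (hbound : ∀ v, ‖abar v‖ ≤ ‖v‖)
    (hell : ∀ v, lam * ‖v‖ ^ 2 ≤ ⟪abar v, v⟫)
    (g : EuclideanSpace ℝ (Fin (m + 1)) → EuclideanSpace ℝ (Fin (m + 1)))
    (hg : ContDiff ℝ (⊤ : ℕ∞) g) (hgc : HasCompactSupport g)
    (hgH : tsupport g ⊆ {x | 0 < x 0})
    (h : EuclideanSpace ℝ (Fin (m + 1)) → ℝ)
    (hh : DifferentiableOn ℝ h {x | 0 < x 0})
    (hreg : ContDiffOn ℝ 1 h (tsupport g)ᶜ)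
    (hweak : ∀ φ : EuclideanSpace ℝ (Fin (m + 1)) → ℝ,
      ContDiff ℝ (⊤ : ℕ∞) φ → HasCompactSupport φ → tsupport φ ⊆ {x | 0 < x 0} →
      ∫ x in {x : EuclideanSpace ℝ (Fin (m + 1)) | 0 < x 0},
          ⟪abar (gradient h x), gradient φ x⟫
        = - ∫ x in {x : EuclideanSpace ℝ (Fin (m + 1)) | 0 < x 0},
            ⟪g x, gradient φ x⟫)
    (C₀ : ℝ)
    (hdecay : ∀ x : EuclideanSpace ℝ (Fin (m + 1)), 0 < x 0 → x ∉ tsupport g →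
      ‖gradient h x‖ ≤ C₀ / (infDist x (tsupport g)) ^ (m + 1))
    (R : ℝ) (hR : 0 ≤ R) (hRg : ∀ x ∈ tsupport g, x 0 ≠ R) :
    Tendsto (fun l : ℝ =>
      ∫ y in {y : EuclideanSpace ℝ (Fin m) | ∀ i, |y i| ≤ l},
        ⟪EuclideanSpace.single (0 : Fin (m + 1)) (1 : ℝ),
          abar (gradient h
            ((WithLp.equiv 2 (∀ _ : Fin (m + 1), ℝ)).symm
              (Fin.cons R ((WithLp.equiv 2 (∀ _ : Fin m, ℝ)) y))))⟫)
      atTop (𝓝 0) := by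
  
  set K := tsupport g with hKdef
  have hK : IsCompact K := hgc
  have hx0 : Continuous fun x : EuclideanSpace ℝ (Fin (m+1)) => x 0 := by fun_prop
  set V : EuclideanSpace ℝ (Fin (m + 1)) → EuclideanSpace ℝ (Fin (m + 1)) :=
    fun x => abar (gradient h x) with hVdef
  obtain ⟨e, L, C, he, hC, hKL, hKR, hdec⟩ := decay_bound m K hK V C₀
    (fun x h1 h2 => (hbound _).trans (hdecay x h1 h2)) R hRg
  have hgm : Measurable (gradient h) :=
    (InnerProductSpace.toDual ℝ _).symm.continuous.measurable.comp (measurable_fderiv ℝ h)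
  have hV : Measurable V := abar.continuous.measurable.comp hgm
  have hVc : ContinuousOn V Kᶜ := by
    have h1 : ContinuousOn (fderiv ℝ h) Kᶜ :=
      hreg.continuousOn_fderiv_of_isOpen (isClosed_tsupport g).isOpen_compl le_rfl
    exact abar.continuous.comp_continuousOn
      ((InnerProductSpace.toDual ℝ _).symm.continuous.comp_continuousOn h1)
  have hkey := key m V hV R e L C hR hC hdec (by
    intro φ hφ1 hφ2 hφ3 hφ4
    have h1 := hweak φ hφ1 hφ2 hφ3
    simp only [inner_gradient_right] at h1
    have h2 : ∀ x, fderiv ℝ φ x (g x) = 0 := by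
      intro x
      by_cases hx : x ∈ K
      · rw [hφ4 x (hKL x hx) (fun hh => hKR x hx ⟨hh.1.le, hh.2.le⟩)]; simp
      · rw [image_eq_zero_of_notMem_tsupport hx]; simp
    simpa [h2] using h1)
  have hdec' : ∀ x, x 0 ∈ Set.Icc R (R + e) → ‖V x‖ ≤ C * (1 + ‖x‖) ^ (-((m : ℝ) + 1)) := by
    intro x hx
    have hxK : x ∉ K := fun hk => hKR x hk hx
    have hcur : Continuous fun s : ℝ => x + s • EuclideanSpace.single (0 : Fin (m + 1)) (1 : ℝ) := by
      fun_prop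
    have hcur0 : Tendsto (fun s : ℝ => x + s • EuclideanSpace.single (0 : Fin (m + 1)) (1 : ℝ))
        (𝓝[>] 0) (𝓝 x) := by
      have := hcur.tendsto 0
      simp only [zero_smul, add_zero] at this
      exact this.mono_left nhdsWithin_le_nhds
    have hVx : Tendsto V (𝓝 x) (𝓝 (V x)) :=
      hVc.continuousAt ((isClosed_tsupport g).isOpen_compl.mem_nhds hxK)
    have hB : Continuous fun x : EuclideanSpace ℝ (Fin (m + 1)) =>
        C * (1 + ‖x‖) ^ (-((m : ℝ) + 1)) := by
      refine continuous_const.mul (Continuous.rpow_const (by fun_prop) fun x => Or.inl ?_)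
      positivity
    by_cases hlt : x 0 < R + e
    · refine le_of_tendsto_of_tendsto ((hVx.comp hcur0).norm) ((hB.tendsto x).comp hcur0) ?_
      have hmem : Set.Ioo (0:ℝ) (R + e - x 0) ∈ 𝓝[>] (0:ℝ) := Ioo_mem_nhdsGT (by linarith)
      filter_upwards [hmem] with s hs
      have hval : (x + s • EuclideanSpace.single (0 : Fin (m + 1)) (1 : ℝ)) 0 = x 0 + s := by
        simp
      refine hdec _ ?_ (Or.inl ?_)
      · rw [hval]; linarith [hx.1, hs.1]
      · rw [hval]; exact ⟨by linarith [hx.1, hs.1], by linarith [hs.2]⟩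
    · exact hdec x (by linarith) (Or.inl hx)
  set G : ℝ → ℝ := fun t => ∫ y, V (sliceE m (t, y)) 0 with hG
  have hV0 : Measurable fun x => V x 0 := hx0.measurable.comp hV
  have hsm : ∀ t, AEStronglyMeasurable (fun y => V (sliceE m (t, y)) 0) volume := fun t =>
    (hV0.comp ((sliceE_cont m).comp (by fun_prop : Continuous fun y => (t, y))).measurable).aestronglyMeasurable
  have hsb : ∀ t ∈ Set.Icc R (R + e), ∀ y, ‖V (sliceE m (t, y)) 0‖ ≤
      C * (1 + ‖y‖) ^ (-((m : ℝ) + 1)) := by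
    intro t ht y
    refine (coord_le_norm _ _).trans ((hdec' _ ?_).trans ?_)
    · rw [sliceE_zero]; exact ht
    · exact mul_le_mul_of_nonneg_left (rpow_slice_le m (t, y)) hC
  have hGc : ContinuousOn G (Set.Icc R (R + e)) := by
    refine continuousOn_of_dominated (fun t _ => hsm t)
      (fun t ht => Eventually.of_forall (hsb t ht)) ((slice_bound_int m).const_mul C)
      (Eventually.of_forall fun y => ?_)
    refine hx0.comp_continuousOn (hVc.comp
      ((sliceE_cont m).comp (by fun_prop : Continuous fun t => (t, y))).continuousOn ?_)
    intro t ht hk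
    have := hKR _ hk
    simp only [Function.comp, sliceE_zero] at this
    exact this ht
  have hae := isOpen_Ioo.ae_eq_zero_of_integral_contDiff_smul_eq_zero (μ := volume)
    ((hGc.mono Set.Ioo_subset_Icc_self).locallyIntegrableOn measurableSet_Ioo) hkey
  have hGR : G R = 0 := by
    by_contra hne
    have h1 : ContinuousWithinAt G (Set.Icc R (R + e)) R := hGc R ⟨le_rfl, by linarith⟩
    have h2 : ∀ᶠ t in 𝓝[Set.Icc R (R + e)] R, G t ≠ 0 := h1.eventually_ne hne
    have h3 : ∀ᶠ t in 𝓝[>] R, G t ≠ 0 := by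
      have : 𝓝[>] R ≤ 𝓝[Set.Icc R (R + e)] R := by
        rw [← nhdsWithin_Ioo_eq_nhdsGT (by linarith : R < R + e)]
        exact nhdsWithin_mono _ Set.Ioo_subset_Icc_self
      exact this h2
    obtain ⟨u, hu, hu2⟩ := (mem_nhdsGT_iff_exists_Ioo_subset).1 h3
    have hu' : R < u := hu
    have hsub : Set.Ioo R (min u (R + e)) ⊆ {t | ¬ (t ∈ Set.Ioo R (R + e) → G t = 0)} := by
      intro t ht hh
      exact hu2 ⟨ht.1, ht.2.trans_le (min_le_left _ _)⟩
        (hh ⟨ht.1, ht.2.trans_le (min_le_right _ _)⟩)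
    have h0 := measure_mono_null hsub hae
    rw [Real.volume_Ioo, ENNReal.ofReal_eq_zero] at h0
    have : R < min u (R + e) := lt_min hu' (by linarith)
    linarith
  have hint : Integrable (fun y => V (sliceE m (R, y)) 0) :=
    ((slice_bound_int m).const_mul C).mono' (hsm R)
      (Eventually.of_forall (hsb R ⟨le_rfl, by linarith⟩))
  have hcov : AECover (volume : Measure (EuclideanSpace ℝ (Fin m))) atTop
      (fun l : ℝ => {y : EuclideanSpace ℝ (Fin m) | ∀ i, |y i| ≤ l}) := by
    refine ⟨Eventually.of_forall fun y => ?_, fun l => ?_⟩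
    · filter_upwards [eventually_ge_atTop ‖y‖] with l hl i
      exact (coord_le_norm y i).trans hl
    · have : {y : EuclideanSpace ℝ (Fin m) | ∀ i, |y i| ≤ l} = ⋂ i, {y | |y i| ≤ l} := by
        ext; simp
      rw [this]
      exact (isClosed_iInter fun i => isClosed_le (by fun_prop) continuous_const).measurableSet
  have hlim := hcov.integral_tendsto_of_countably_generated hint
  rw [show ∫ y, V (sliceE m (R, y)) 0 = 0 from hGR] at hlim
  refine hlim.congr fun l => ?_
  congr 1
  funext y
  rw [EuclideanSpace.inner_single_left]
  simp only [map_one, one_mul]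
  rfl
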